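/- Let A_n : dom(A_n) ⊆ 𝔉 → 𝔉 (n ∈ ℕ) be densely defined closable operators with 𝔥₁ ⊆ dom(A_n) ∩ dom(A_n*) such that: A_n|𝔥₁ ∈ B(𝔥₁,𝔉); for each n, A_n* + A_n is H-bounded with relative bound < 1 on 𝔥₁, so that H_n := H + A_n* + A_n is self-adjoint with dom(H_n) = 𝔥₁; and the map φ ↦ A_nRA_n*φ, defined for φ ∈ dom(A_n*), extends to a bounded symmetric operator A_nRA_n* ∈ B(𝔉). Set H̃_n := H_n − A_nRA_n* (self-adjoint with dom(H̃_n) = 𝔥₁). If ‖(A_n − A)|𝔥₁‖_{B(𝔥₁,𝔉)} → 0, then H̃_n converges to Ĥ₀ in norm-resolvent sense. If, moreover, T : dom(T) ⊆ 𝔉 → 𝔉 is symmetric with dom(T) ⊇ dom(Ĥ₀) and Ĥ₀-bounded with relative bound < 1 (so that Ĥ_T := Ĥ₀ + T is self-adjoint), and there exist bounded symmetric operators E_n ∈ B(𝔉) and constants ã < 1, c ≥ 0 independent of n such that ‖(A_nRA_n* + E_n)ψ‖ ≤ ã‖H̃_nψ‖ + c‖ψ‖ for all ψ ∈ 𝔥₁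 and n, and ‖(A_nRA_n* + E_n − T)|dom(T)‖_{B(dom(T),𝔉)} → 0 (dom(T) equipped with the graph norm of T), then H_n + E_n converges to Ĥ_T in norm-resolvent sense. -/

import Mathlib

noncomputable section

open scoped ComplexInnerProductSpace
open ContinuousLinearMap Filter

variable {F X : Type*}
  [NormedAddCommGroup F] [InnerProductSpace ℂ F] [CompleteSpace F]
  [NormedAddCommGroup X] [InnerProductSpace ℂ X] [CompleteSpace X]

/-- `W R l z = 1 + (z - l) • R`; the point `z` belongs to the resolvent set of the
self-adjoint operator `H` iff `W R l z` is boundedly invertible, where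
`R = (-H + λ₀)⁻¹` and `l = λ₀ ∈ ϱ(H) ∩ ℝ` encode `H`. -/
def W (R : F →L[ℂ] F) (l : ℝ) (z : ℂ) : F →L[ℂ] F := 1 + (z - (l : ℂ)) • R

/-- The resolvent set `ϱ(H)` of `H`, encoded through `R = (-H + λ₀)⁻¹`. -/
def res (R : F →L[ℂ] F) (l : ℝ) : Set ℂ := {z | IsUnit (W R l z)}

/-- The resolvent `R_z = (-H + z)⁻¹`. -/
def Rz (R : F →L[ℂ] F) (l : ℝ) (z : ℂ) : F →L[ℂ] F := R ∘L Ring.inverse (W R l z)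

/-- `G_z = (Σ R_z̄)*`, where the bounded operator `B = Σ ∘ R : 𝔉 →L 𝔛` encodes the
(graph-norm bounded) operator `Σ : 𝔥₁ → 𝔛`. -/
def Gz (R : F →L[ℂ] F) (B : F →L[ℂ] X) (l : ℝ) (z : ℂ) : X →L[ℂ] F :=
  adjoint (B ∘L Ring.inverse (W R l (starRingEnd ℂ z)))

/-- `(-H + λ₀) ψ`, for `ψ ∈ dom H = ran R`. -/
def Hinv (R : F →L[ℂ] F) (ψ : F) : F := Function.invFun (⇑R) ψ

/-- `Σ ψ`, for `ψ ∈ dom H = ran R`. -/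
def SigmaOf (R : F →L[ℂ] F) (B : F →L[ℂ] X) (ψ : F) : X := B (Hinv R ψ)

/-- `Q` is the resolvent `(-K + z)⁻¹` of the (in general unbounded) operator `K`. -/
def IsResolventAt (K : F →ₗ.[ℂ] F) (z : ℂ) (Q : F →L[ℂ] F) : Prop :=
  (∀ ψ : F, Q ψ ∈ K.domain) ∧
  (∀ (ψ : F) (h : Q ψ ∈ K.domain), z • Q ψ - K ⟨Q ψ, h⟩ = ψ) ∧
  (∀ ψ : K.domain, Q (z • (ψ : F) - K ψ) = (ψ : F))

/-- The resolvent set of the (in general unbounded) operator `K`. -/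
def pres (K : F →ₗ.[ℂ] F) : Set ℂ := {z | ∃ Q : F →L[ℂ] F, IsResolventAt K z Q}

/-- `K - S`, for an (unbounded) operator `K` and a bounded operator `S`. -/
def pmapSub (K : F →ₗ.[ℂ] F) (S : F →L[ℂ] F) : F →ₗ.[ℂ] F :=
  K + ((-S : F →L[ℂ] F) : F →ₗ[ℂ] F).toPMap ⊤

/-- `K + S`, for an (unbounded) operator `K` and a bounded operator `S`. -/
def pmapAddB (K : F →ₗ.[ℂ] F) (S : F →L[ℂ] F) : F →ₗ.[ℂ] F :=
  K + ((S : F →L[ℂ] F) : F →ₗ[ℂ] F).toPMap ⊤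

lemma Gz_self (R : F →L[ℂ] F) (B : F →L[ℂ] X) (l : ℝ) : Gz R B l l = adjoint B := by
  have h : Ring.inverse (W R l (starRingEnd ℂ l)) = 1 := by simp [W]
  rw [Gz, h]
  rfl

lemma inner_apply_eq_of_isSelfAdjoint {P : F →L[ℂ] F} (hP : IsSelfAdjoint P) (x y : F) :
    ⟪P x, y⟫ = ⟪x, P y⟫ := by
  rw [← adjoint_inner_right, hP.adjoint_eq]

/-- A self-adjoint operator is symmetric. -/
lemma LinearPMap.inner_apply_eq_of_isSelfAdjoint {N : F →ₗ.[ℂ] F} (hN : IsSelfAdjoint N)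
    (x y : N.domain) : ⟪N x, (y : F)⟫ = ⟪(x : F), N y⟫ := by
  have h : N.IsFormalAdjoint N := by
    have h' := LinearPMap.adjoint_isFormalAdjoint hN.dense_domain
    rwa [LinearPMap.isSelfAdjoint_def.mp hN] at h'
  exact h x y

lemma pmapAddB_apply {E : Type*} [NormedAddCommGroup E] [InnerProductSpace ℂ E]
    (N : E →ₗ.[ℂ] E) (P : E →L[ℂ] E) (ψ : E) (h : ψ ∈ (pmapAddB N P).domain) :
    pmapAddB N P ⟨ψ, h⟩ = N ⟨ψ, h.1⟩ + P ψ := rfl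

lemma pmapSub_apply {E : Type*} [NormedAddCommGroup E] [InnerProductSpace ℂ E]
    (N : E →ₗ.[ℂ] E) (S : E →L[ℂ] E) (ψ : E) (h : ψ ∈ (pmapSub N S).domain) :
    pmapSub N S ⟨ψ, h⟩ = N ⟨ψ, h.1⟩ - S ψ := by
  rw [sub_eq_add_neg]
  rfl

lemma mem_pmapAddB_domain {E : Type*} [NormedAddCommGroup E] [InnerProductSpace ℂ E]
    {N : E →ₗ.[ℂ] E} (P : E →L[ℂ] E) {ψ : E} (h : ψ ∈ N.domain) :
    ψ ∈ (pmapAddB N P).domain := ⟨h, Submodule.mem_top⟩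

/-- The range of the adjoint of a resolvent of `N + P` at `z` lies in the domain of the
self-adjoint operator `N`, and the adjoint is a right inverse of `z̄ - (N + P)`. -/
lemma IsResolventAt.adjoint_right_inverse {N : F →ₗ.[ℂ] F} (hN : IsSelfAdjoint N)
    {P : F →L[ℂ] F} (hP : IsSelfAdjoint P) {z : ℂ} {Q : F →L[ℂ] F}
    (hQ : IsResolventAt (pmapAddB N P) z Q) (η : F) :
    ∃ h : adjoint Q η ∈ N.domain,
      starRingEnd ℂ z • adjoint Q η - (N ⟨adjoint Q η, h⟩ + P (adjoint Q η)) = η := by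
  have key : ∀ x : N.domain,
      ⟪starRingEnd ℂ z • adjoint Q η - P (adjoint Q η) - η, (x : F)⟫ = ⟪adjoint Q η, N x⟫ := by
    intro x
    have h1 : Q (z • (x : F) - (N x + P x)) = x := hQ.2.2 ⟨x, mem_pmapAddB_domain P x.2⟩
    have h2 : ⟪η, (x : F)⟫ = ⟪adjoint Q η, z • (x : F) - (N x + P x)⟫ := by
      rw [adjoint_inner_left, h1]
    rw [inner_sub_left, inner_sub_left, h2, inner_sub_right, inner_add_right, inner_smul_left,
      inner_smul_right, inner_apply_eq_of_isSelfAdjoint hP, Complex.conj_conj]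
    ring
  have hadj := LinearPMap.isSelfAdjoint_def.mp hN
  have hmem : adjoint Q η ∈ N.adjoint.domain :=
    LinearPMap.mem_adjoint_domain_of_exists _ ⟨_, key⟩
  have hval := LinearPMap.adjoint_apply_eq hN.dense_domain ⟨_, hmem⟩ key
  have hgen : ∀ N' : F →ₗ.[ℂ] F, N' = N → ∀ h : adjoint Q η ∈ N'.domain,
      N' ⟨adjoint Q η, h⟩ = starRingEnd ℂ z • adjoint Q η - P (adjoint Q η) - η →
      ∃ h : adjoint Q η ∈ N.domain,
        starRingEnd ℂ z • adjoint Q η - (N ⟨adjoint Q η, h⟩ + P (adjoint Q η)) = η := by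
    rintro N' rfl h h'
    refine ⟨h, ?_⟩
    rw [h']
    abel
  exact hgen _ hadj hmem hval

/-- The resolvent of a self-adjoint operator at `z` is bounded by `1 / |Im z|`. -/
lemma IsResolventAt.norm_le {N : F →ₗ.[ℂ] F} (hN : IsSelfAdjoint N)
    {P : F →L[ℂ] F} (hP : IsSelfAdjoint P) {z : ℂ} (hz : z.im ≠ 0) {Q : F →L[ℂ] F}
    (hQ : IsResolventAt (pmapAddB N P) z Q) : ‖Q‖ ≤ |z.im|⁻¹ := by
  have hz' : 0 < |z.im| := abs_pos.mpr hz
  refine Q.opNorm_le_bound (by positivity) fun η => ?_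
  have hmem := hQ.1 η
  have h := hQ.2.1 η hmem
  rw [pmapAddB_apply] at h
  generalize Q η = ψ at hmem h ⊢
  have hNr : (⟪ψ, N ⟨ψ, hmem.1⟩⟫).im = 0 := by
    rw [← Complex.conj_eq_iff_im, inner_conj_symm]
    exact LinearPMap.inner_apply_eq_of_isSelfAdjoint hN ⟨ψ, hmem.1⟩ ⟨ψ, hmem.1⟩
  have hPr : (⟪ψ, P ψ⟫).im = 0 := by
    rw [← Complex.conj_eq_iff_im, inner_conj_symm]
    exact inner_apply_eq_of_isSelfAdjoint hP ψ ψ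
  have him : (⟪ψ, η⟫).im = z.im * ‖ψ‖ ^ 2 := by
    rw [← h, inner_sub_right, inner_add_right, inner_smul_right, inner_self_eq_norm_sq_to_K]
    simp only [Complex.sub_im, Complex.add_im, hNr, hPr]
    simp [← Complex.ofReal_pow]
  have hle : |z.im| * ‖ψ‖ ^ 2 ≤ ‖ψ‖ * ‖η‖ := by
    calc |z.im| * ‖ψ‖ ^ 2 = |(⟪ψ, η⟫).im| := by rw [him, abs_mul, abs_of_nonneg (sq_nonneg ‖ψ‖)]
      _ ≤ ‖⟪ψ, η⟫‖ := Complex.abs_im_le_norm _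
      _ ≤ ‖ψ‖ * ‖η‖ := norm_inner_le_norm _ _
  rw [inv_mul_eq_div, le_div_iff₀ hz']
  rcases (norm_nonneg ψ).eq_or_lt with h0 | h0
  · rw [← h0]
    simp
  · nlinarith

/-- A resolvent of `N + P` at `z` in terms of a bounded left inverse `K` of `l - (N - S)`. -/
lemma IsResolventAt.eq_left_inverse_apply {E : Type*} [NormedAddCommGroup E] [InnerProductSpace ℂ E]
    {N : E →ₗ.[ℂ] E} {P S K : E →L[ℂ] E} {l : ℝ}
    (hK : ∀ ψ : N.domain, K ((l : ℂ) • (ψ : E) - (N ψ - S ψ)) = ψ)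
    {z : ℂ} {ψ η : E} (hψ : ψ ∈ N.domain) (h : z • ψ - (N ⟨ψ, hψ⟩ + P ψ) = η) :
    ψ = K (η + (((l : ℂ) - z) • (1 : E →L[ℂ] E) + (S + P)) ψ) := by
  refine (hK ⟨ψ, hψ⟩).symm.trans (congrArg K ?_)
  change _ = η + (((l : ℂ) - z) • ψ + (S ψ + P ψ))
  rw [← h, sub_smul]
  abel

/-- Two-sided resolvent identity for a resolvent of `N + P` at `z` and a bounded self-adjoint
left inverse `K` of `l - (N - S)`. -/
lemma IsResolventAt.eq_add_mul {N : F →ₗ.[ℂ] F} (hN : IsSelfAdjoint N)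
    {P S K : F →L[ℂ] F} (hP : IsSelfAdjoint P) (hS : IsSelfAdjoint S) (hKsa : IsSelfAdjoint K)
    {l : ℝ} (hK : ∀ ψ : N.domain, K ((l : ℂ) • (ψ : F) - (N ψ - S ψ)) = ψ)
    {z : ℂ} {Q : F →L[ℂ] F} (hQ : IsResolventAt (pmapAddB N P) z Q) :
    Q = K + K * (((l : ℂ) - z) • 1 + (S + P)) * Q ∧
      Q = K + Q * (((l : ℂ) - z) • 1 + (S + P)) * K := by
  constructor
  · ext η
    have h := eq_left_inverse_apply hK (hQ.1 η).1 (hQ.2.1 η (hQ.1 η))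
    rwa [map_add] at h
  · have h : star Q = K + K * (((l : ℂ) - starRingEnd ℂ z) • 1 + (S + P)) * star Q := by
      ext η
      obtain ⟨hmem, hη⟩ := hQ.adjoint_right_inverse hN hP η
      have h := eq_left_inverse_apply hK hmem hη
      rwa [map_add] at h
    have h' := congrArg star h
    simpa [hKsa.star_eq, hS.star_eq, hP.star_eq, mul_assoc] using h'

lemma smul_sub_eq_of_smul_sub_eq {E : Type*} [AddCommGroup E] [Module ℂ E] {w z : ℂ}
    {φ k v η : E} (h : z • φ - (k + v) = η) : w • φ - k = η + ((w - z) • φ + v) := by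
  rw [← h, sub_smul]
  abel

/-- The bound on `v` resulting from a relative bound `v ≤ a h + c q` with `a < 1`. -/
lemma le_of_relative_bound {a c h q v w : ℝ} (ha : a < 1) (hv : v ≤ a * h + c * q)
    (hhv : h ≤ w + v) (hvh : v ≤ w + h) : v ≤ w + (w + c * q) / (1 - a) := by
  have h1 : h ≤ (w + c * q) / (1 - a) := by
    rw [le_div_iff₀ (by linarith)]
    nlinarith
  linarith

/-- Uniform bound for `V Q` when `V` is bounded relative to an operator that differs from `-V`
by `z - Q⁻¹`. -/
lemma norm_le_of_relative_bound {E : Type*} [NormedAddCommGroup E] [InnerProductSpace ℂ E]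
    {a c C : ℝ} (ha : a < 1) {z : ℂ} {k v φ η : E}
    (hφ : ‖φ‖ ≤ C * ‖η‖) (hk : z • φ - (k + v) = η) (hv : ‖v‖ ≤ a * ‖k‖ + c * ‖φ‖) :
    ‖v‖ ≤ ((‖z‖ * C + 1) + (‖z‖ * C + 1 + |c| * C) / (1 - a)) * ‖η‖ := by
  have hw : ‖z • φ - η‖ ≤ (‖z‖ * C + 1) * ‖η‖ := by
    calc ‖z • φ - η‖ ≤ ‖z‖ * ‖φ‖ + ‖η‖ := (norm_sub_le _ _).trans (by rw [norm_smul])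
      _ ≤ ‖z‖ * (C * ‖η‖) + ‖η‖ := by gcongr
      _ = _ := by ring
  have hc : c * ‖φ‖ ≤ |c| * C * ‖η‖ := by
    calc c * ‖φ‖ ≤ |c| * ‖φ‖ := by gcongr; exact le_abs_self c
      _ ≤ |c| * (C * ‖η‖) := by gcongr
      _ = _ := by ring
  have hkv' : z • φ - η = k + v := by rw [← hk, sub_sub_cancel]
  have hkv : ‖k‖ ≤ ‖z • φ - η‖ + ‖v‖ := by
    simpa [hkv'] using norm_sub_le (k + v) v
  have hvk : ‖v‖ ≤ ‖z • φ - η‖ + ‖k‖ := by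
    simpa [hkv'] using norm_sub_le (k + v) k
  have ha' : 0 < 1 - a := by linarith
  calc ‖v‖ ≤ ‖z • φ - η‖ + (‖z • φ - η‖ + c * ‖φ‖) / (1 - a) := le_of_relative_bound ha hv hkv hvk
    _ ≤ (‖z‖ * C + 1) * ‖η‖ + ((‖z‖ * C + 1) * ‖η‖ + |c| * C * ‖η‖) / (1 - a) := by gcongr
    _ = _ := by ring

/-- Quantitative stability of the solution `Q` of `Q = K (1 + m Q + t)` under perturbation. -/
lemma norm_sub_le_of_resolvent_identity {E : Type*} [NormedAddCommGroup E] [InnerProductSpace ℂ E]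
    {K K' V Q Q' : E →L[ℂ] E} {m : ℂ} {t : E → E}
    {C C₁ C₂ ε : ℝ} (hε : 0 ≤ ε) (hC : 0 ≤ C) (hC₁ : 0 ≤ C₁) (hC₂ : 0 ≤ C₂)
    (hQ : ∀ η, Q η = K (η + (m • Q η + t η))) (ht : ∀ η, ‖t η‖ ≤ C * ‖η‖)
    (hVt : ∀ η, ‖V (Q η) - t η‖ ≤ ε * ‖η‖)
    (hQ' : Q' = K' + K' * (m • 1 + V) * Q') (hQ'' : Q' = K' + Q' * (m • 1 + V) * K')
    (hQ'norm : ‖Q'‖ ≤ C₁) (hVQ' : ‖Q' * V‖ ≤ C₂) :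
    ‖Q' - Q‖ ≤ (1 + ‖m‖ * C₁ + C₂) *
      (‖K' - K‖ * (1 + ‖m‖ * ‖Q‖ + C) + ‖K'‖ * ε) := by
  refine opNorm_le_bound _ (by positivity) fun η => ?_
  set M : E →L[ℂ] E := m • 1 + V with hM
  have hMapp : ∀ x, M x = m • x + V x := fun x => rfl
  set x := (Q' - Q) η with hx
  set f := η + (m • Q η + t η) with hf
  set r := (K' - K) f + K' (V (Q η) - t η) with hr
  have hxr : x = K' (M x) + r := by
    have h1 : Q' η = K' η + K' (M (Q' η)) := congrArg (fun T : E →L[ℂ] E => T η) hQ'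
    have h2 : r = K' η + K' (M (Q η)) - Q η := by
      rw [hr, hQ η, ← hQ η, _root_.sub_apply, ← hQ η, hMapp, hf]
      simp only [map_add, map_sub]
      abel
    rw [h2, hx, _root_.sub_apply, map_sub, map_sub]
    nth_rewrite 1 [h1]
    abel
  have hxr' : x = r + Q' (M r) := by
    have h1 : Q' (M x) = K' (M x) + Q' (M (K' (M x))) :=
      congrArg (fun T : E →L[ℂ] E => T (M x)) hQ''
    have h2 : r = x - K' (M x) := by
      nth_rewrite 1 [hxr]
      abel
    rw [h2, map_sub, map_sub, h1]
    abel
  have hfn : ‖f‖ ≤ (1 + ‖m‖ * ‖Q‖ + C) * ‖η‖ := by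
    calc ‖f‖ ≤ ‖η‖ + (‖m • Q η‖ + ‖t η‖) := norm_add_le_of_le le_rfl (norm_add_le _ _)
      _ ≤ ‖η‖ + (‖m‖ * (‖Q‖ * ‖η‖) + C * ‖η‖) := by
        rw [norm_smul]
        gcongr
        · exact Q.le_opNorm η
        · exact ht η
      _ = _ := by ring
  have hrn : ‖r‖ ≤ (‖K' - K‖ * (1 + ‖m‖ * ‖Q‖ + C) + ‖K'‖ * ε) * ‖η‖ := by
    calc ‖r‖ ≤ ‖K' - K‖ * ‖f‖ + ‖K'‖ * ‖V (Q η) - t η‖ :=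
          norm_add_le_of_le (le_opNorm _ _) (le_opNorm _ _)
      _ ≤ ‖K' - K‖ * ((1 + ‖m‖ * ‖Q‖ + C) * ‖η‖) + ‖K'‖ * (ε * ‖η‖) := by
        gcongr
        exact hVt η
      _ = _ := by ring
  have hsplit : Q' (M r) = m • Q' r + (Q' * V) r := by
    rw [hMapp, map_add, map_smul]
    rfl
  calc ‖x‖ ≤ ‖r‖ + (‖m • Q' r‖ + ‖(Q' * V) r‖) := by
        nth_rewrite 1 [hxr']
        rw [hsplit]
        exact norm_add_le_of_le le_rfl (norm_add_le _ _)
    _ ≤ ‖r‖ + (‖m‖ * (C₁ * ‖r‖) + C₂ * ‖r‖) := by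
        rw [norm_smul]
        gcongr
        · exact Q'.le_of_opNorm_le hQ'norm r
        · exact (Q' * V).le_of_opNorm_le hVQ' r
    _ = (1 + ‖m‖ * C₁ + C₂) * ‖r‖ := by ring
    _ ≤ (1 + ‖m‖ * C₁ + C₂) * ((‖K' - K‖ * (1 + ‖m‖ * ‖Q‖ + C) + ‖K'‖ * ε) * ‖η‖) := by gcongr
    _ = _ := by ring

/-- Convergence version of `norm_sub_le_of_resolvent_identity`. -/
lemma tendsto_of_resolvent_identity {E : Type*} [NormedAddCommGroup E] [InnerProductSpace ℂ E]
    {K Q : E →L[ℂ] E} {Kn Vn Qn : ℕ → E →L[ℂ] E}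
    {m : ℂ} {t : E → E} {C C₁ C₂ : ℝ} {ε : ℕ → ℝ} (hC : 0 ≤ C) (hC₁ : 0 ≤ C₁) (hC₂ : 0 ≤ C₂)
    (hKn : Tendsto Kn atTop (nhds K)) (hε : ∀ n, 0 ≤ ε n) (hε0 : Tendsto ε atTop (nhds 0))
    (hQ : ∀ η, Q η = K (η + (m • Q η + t η))) (ht : ∀ η, ‖t η‖ ≤ C * ‖η‖)
    (hVt : ∀ n η, ‖Vn n (Q η) - t η‖ ≤ ε n * ‖η‖)
    (hQn : ∀ᶠ n in atTop, Qn n = Kn n + Kn n * (m • 1 + Vn n) * Qn n ∧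
      Qn n = Kn n + Qn n * (m • 1 + Vn n) * Kn n)
    (hQnorm : ∀ n, ‖Qn n‖ ≤ C₁) (hVQ : ∀ n, ‖Qn n * Vn n‖ ≤ C₂) :
    Tendsto (fun n => ‖Qn n - Q‖) atTop (nhds 0) := by
  have hlim : Tendsto (fun n => (1 + ‖m‖ * C₁ + C₂) *
      (‖Kn n - K‖ * (1 + ‖m‖ * ‖Q‖ + C) + ‖Kn n‖ * ε n)) atTop (nhds 0) := by
    have h := (((tendsto_iff_norm_sub_tendsto_zero.mp hKn).mul_const
      (1 + ‖m‖ * ‖Q‖ + C)).add (hKn.norm.mul hε0)).const_mul (1 + ‖m‖ * C₁ + C₂)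
    simpa using h
  refine squeeze_zero' (Eventually.of_forall fun n => norm_nonneg _) ?_ hlim
  filter_upwards [hQn] with n hn
  exact norm_sub_le_of_resolvent_identity (hε n) hC hC₁ hC₂ hQ ht (hVt n) hn.1 hn.2
    (hQnorm n) (hVQ n)

/-- `(1 - B*)⁻¹ R (1 - B)⁻¹`, the resolvent of the operator `l - (1 - B)(-H + l)(1 - B*)`
at `l`. -/
def dressedResolvent (R B : F →L[ℂ] F) : F →L[ℂ] F :=
  Ring.inverse (1 - star B) * R * Ring.inverse (1 - B)

lemma isSelfAdjoint_dressedResolvent {R : F →L[ℂ] F} (hR : IsSelfAdjoint R) (B : F →L[ℂ] F) :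
    IsSelfAdjoint (dressedResolvent R B) := by
  rw [isSelfAdjoint_iff, dressedResolvent]
  simp [← Ring.inverse_star, hR.star_eq, mul_assoc]

lemma tendsto_dressedResolvent (R : F →L[ℂ] F) {B : F →L[ℂ] F} {Bn : ℕ → F →L[ℂ] F}
    (h1 : IsUnit (1 - B)) (h2 : IsUnit (1 - star B)) (hB : Tendsto Bn atTop (nhds B)) :
    Tendsto (fun n => dressedResolvent R (Bn n)) atTop (nhds (dressedResolvent R B)) := by
  obtain ⟨u, hu⟩ := h1
  obtain ⟨v, hv⟩ := h2
  have hu' := NormedRing.inverse_continuousAt u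
  have hv' := NormedRing.inverse_continuousAt v
  rw [ContinuousAt, hu] at hu'
  rw [ContinuousAt, hv] at hv'
  exact ((hv'.comp (hB.star.const_sub 1)).mul_const R).mul (hu'.comp (hB.const_sub 1))

/-- `dressedResolvent R Bn` is a left inverse of `l - (H + A* + A - A R A*)`, where
`Bn = A R`. -/
lemma dressedResolvent_left_inverse {R B S : F →L[ℂ] F} {l : ℝ} (hR : IsSelfAdjoint R)
    (h1 : IsUnit (1 - B)) (h2 : IsUnit (1 - star B)) {A N : F →ₗ.[ℂ] F}
    (hA : Set.range ⇑R ⊆ (A.domain : Set F)) (hA' : Set.range ⇑R ⊆ (A.adjoint.domain : Set F))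
    (hdense : Dense (A.domain : Set F))
    (hB : ∀ (χ : F) (h : R χ ∈ A.domain), A ⟨R χ, h⟩ = B χ)
    (hNdom : (N.domain : Set F) = Set.range ⇑R)
    (hNact : ∀ (χ : F) (h : R χ ∈ N.domain) (h1 : R χ ∈ A.domain) (h2 : R χ ∈ A.adjoint.domain),
      N ⟨R χ, h⟩ = (l : ℂ) • R χ - χ + (A.adjoint ⟨R χ, h2⟩ + A ⟨R χ, h1⟩))
    (hS : ∀ φ : A.adjoint.domain, S (φ : F) = B (A.adjoint φ)) (ψ : N.domain) :
    dressedResolvent R B ((l : ℂ) • (ψ : F) - (N ψ - S ψ)) = ψ := by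
  obtain ⟨ψ, hψ⟩ := ψ
  obtain ⟨χ, rfl⟩ : ψ ∈ Set.range ⇑R := hNdom ▸ hψ
  have m1 : R χ ∈ A.domain := hA ⟨χ, rfl⟩
  have m2 : R χ ∈ A.adjoint.domain := hA' ⟨χ, rfl⟩
  set a := A.adjoint ⟨R χ, m2⟩ with ha
  have hRa : R a = star B (R χ) := by
    refine ext_inner_right ℂ fun η => ?_
    rw [star_eq_adjoint, adjoint_inner_left, inner_apply_eq_of_isSelfAdjoint hR,
      ← hB η (hA ⟨η, rfl⟩)]
    exact LinearPMap.adjoint_isFormalAdjoint hdense ⟨R χ, m2⟩ ⟨R η, hA ⟨η, rfl⟩⟩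
  have hS' : S (R χ) = B a := hS ⟨R χ, m2⟩
  have hl : (l : ℂ) • R χ - (N ⟨R χ, hψ⟩ - S (R χ)) = (1 - B) (χ - a) := by
    rw [hNact χ hψ m1 m2, hB χ m1, hS', ← ha]
    simp only [_root_.sub_apply, one_apply_eq_self, map_sub]
    abel
  have hi1 : Ring.inverse (1 - B) ((1 - B) (χ - a)) = χ - a :=
    congrArg (fun T : F →L[ℂ] F => T (χ - a)) (Ring.inverse_mul_cancel _ h1)
  have hi2 : Ring.inverse (1 - star B) ((1 - star B) (R χ)) = R χ :=
    congrArg (fun T : F →L[ℂ] F => T (R χ)) (Ring.inverse_mul_cancel _ h2)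
  have hR' : R (χ - a) = (1 - star B) (R χ) := by
    rw [map_sub, hRa]
    rfl
  change Ring.inverse (1 - star B) (R (Ring.inverse (1 - B)
    ((l : ℂ) • R χ - (N ⟨R χ, hψ⟩ - S (R χ))))) = R χ
  rw [hl, hi1, hR', hi2]

/-- Approximation of `Ĥ₀` and `Ĥ_T` by regular perturbations:
if `‖(Aₙ - A)|𝔥₁‖ → 0` then `H̃ₙ := Hₙ - Aₙ R Aₙ* → Ĥ₀` in norm-resolvent sense; if
moreover `T` is symmetric, `Ĥ₀`-bounded with relative bound `< 1`, and the bounded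
symmetric operators `Eₙ` satisfy the stated uniform relative bound and
`‖(Aₙ R Aₙ* + Eₙ - T)|dom T‖ → 0`, then `Hₙ + Eₙ → Ĥ_T = Ĥ₀ + T` in norm-resolvent
sense. -/
theorem statement16
    (R B : F →L[ℂ] F) (l : ℝ)
    (hR : IsSelfAdjoint R) (hinj : Function.Injective ⇑R)
    -- `H` is bounded from below
    (hsemib : ∃ m : ℝ, ∀ χ : F, m * ‖R χ‖ ^ 2 ≤ (⟪R χ, (l : ℂ) • R χ - χ⟫).re)
    -- `1 - G` and `1 - G*` have bounded inverses
    (hunit : IsUnit (1 - Gz R B l l) ∧ IsUnit (1 - adjoint (Gz R B l l)))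
    -- the self-adjoint operator `Ĥ₀`
    (Hhat0 : F →ₗ.[ℂ] F) (hsa0 : IsSelfAdjoint Hhat0)
    (hdom0 : (Hhat0.domain : Set F) = {ψ | ψ - Gz R B l l ψ ∈ Set.range ⇑R})
    (hact0 : ∀ (ψ : Hhat0.domain) (χ : F),
      (ψ : F) - Gz R B l l (ψ : F) = R χ →
      Hhat0 ψ = (l : ℂ) • (ψ : F) - (χ - adjoint (Gz R B l l) χ))
    (hres0 : IsResolventAt Hhat0 (l : ℂ)
      (Ring.inverse (1 - Gz R B l l) ∘L R ∘L Ring.inverse (1 - adjoint (Gz R B l l))))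
    -- the operators `Aₙ`, densely defined and closable, `𝔥₁ ⊆ dom Aₙ ∩ dom Aₙ*`,
    -- with `Aₙ|𝔥₁` bounded (encoded by `Bn n = Aₙ ∘ R`)
    (An : ℕ → F →ₗ.[ℂ] F) (Bn : ℕ → F →L[ℂ] F)
    (hAdom : ∀ n, Set.range ⇑R ⊆ ((An n).domain : Set F))
    (hAdomStar : ∀ n, Set.range ⇑R ⊆ ((An n).adjoint.domain : Set F))
    (hAdense : ∀ n, Dense ((An n).domain : Set F))
    (hAclos : ∀ n, (An n).IsClosable)
    (hBn : ∀ (n : ℕ) (χ : F) (h : R χ ∈ (An n).domain), An n ⟨R χ, h⟩ = Bn n χ)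
    -- `Aₙ* + Aₙ` is `H`-bounded with relative bound `< 1`, so that
    -- `Hₙ = H + Aₙ* + Aₙ` is self-adjoint with `dom Hₙ = 𝔥₁`
    (hrel : ∀ n, ∃ a : ℝ, a < 1 ∧ ∃ c : ℝ,
      ∀ (χ : F) (h1 : R χ ∈ (An n).domain) (h2 : R χ ∈ (An n).adjoint.domain),
        ‖(An n).adjoint ⟨R χ, h2⟩ + An n ⟨R χ, h1⟩‖
          ≤ a * ‖(l : ℂ) • R χ - χ‖ + c * ‖R χ‖)
    (Hn : ℕ → F →ₗ.[ℂ] F) (hHnsa : ∀ n, IsSelfAdjoint (Hn n))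
    (hHndom : ∀ n, ((Hn n).domain : Set F) = Set.range ⇑R)
    (hHnact : ∀ (n : ℕ) (χ : F) (h : R χ ∈ (Hn n).domain)
        (h1 : R χ ∈ (An n).domain) (h2 : R χ ∈ (An n).adjoint.domain),
      Hn n ⟨R χ, h⟩
        = (l : ℂ) • R χ - χ + ((An n).adjoint ⟨R χ, h2⟩ + An n ⟨R χ, h1⟩))
    -- `Aₙ R Aₙ*` extends to the bounded symmetric operator `Sn n`
    (Sn : ℕ → F →L[ℂ] F) (hSnsa : ∀ n, IsSelfAdjoint (Sn n))
    (hSn : ∀ (n : ℕ) (φ : (An n).adjoint.domain),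
      Sn n (φ : F) = Bn n ((An n).adjoint φ))
    -- `‖(Aₙ - A)|𝔥₁‖ → 0`
    (hBconv : Tendsto (fun n => ‖Bn n - B‖) atTop (nhds 0)) :
    -- first conclusion: `H̃ₙ = Hₙ - Aₙ R Aₙ* → Ĥ₀` in norm-resolvent sense
    (∀ z : ℂ, z.im ≠ 0 →
      ∀ (Q : F →L[ℂ] F) (Qn : ℕ → F →L[ℂ] F),
        IsResolventAt Hhat0 z Q →
        (∀ n, IsResolventAt (pmapSub (Hn n) (Sn n)) z (Qn n)) →
        Tendsto (fun n => ‖Qn n - Q‖) atTop (nhds 0)) ∧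
    -- second conclusion: `Hₙ + Eₙ → Ĥ_T = Ĥ₀ + T` in norm-resolvent sense
    (∀ T : F →ₗ.[ℂ] F,
      (∀ x y : T.domain, ⟪T x, (y : F)⟫ = ⟪(x : F), T y⟫) →
      Hhat0.domain ≤ T.domain →
      (∃ a : ℝ, a < 1 ∧ ∃ c : ℝ,
        ∀ (ψ : Hhat0.domain) (h : (ψ : F) ∈ T.domain),
          ‖T ⟨(ψ : F), h⟩‖ ≤ a * ‖Hhat0 ψ‖ + c * ‖(ψ : F)‖) →
      ∀ En : ℕ → F →L[ℂ] F, (∀ n, IsSelfAdjoint (En n)) →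
      (∃ at' : ℝ, at' < 1 ∧ ∃ c : ℝ,
        ∀ (n : ℕ) (χ : F) (h : R χ ∈ (pmapSub (Hn n) (Sn n)).domain),
          ‖(Sn n + En n) (R χ)‖
            ≤ at' * ‖pmapSub (Hn n) (Sn n) ⟨R χ, h⟩‖ + c * ‖R χ‖) →
      (∃ ε : ℕ → ℝ, Tendsto ε atTop (nhds 0) ∧
        ∀ (n : ℕ) (φ : T.domain),
          ‖(Sn n + En n) (φ : F) - T φ‖ ≤ ε n * (‖(φ : F)‖ + ‖T φ‖)) →
      ∀ z : ℂ, z.im ≠ 0 →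
        ∀ (Q : F →L[ℂ] F) (Qn : ℕ → F →L[ℂ] F),
          IsResolventAt (Hhat0 + T) z Q →
          (∀ n, IsResolventAt (pmapAddB (Hn n) (En n)) z (Qn n)) →
          Tendsto (fun n => ‖Qn n - Q‖) atTop (nhds 0)) := by
  rw [Gz_self, adjoint_adjoint] at hunit hres0
  obtain ⟨hu2, hu1⟩ := hunit
  have hBlim : Tendsto Bn atTop (nhds B) := tendsto_iff_norm_sub_tendsto_zero.mpr hBconv
  have hKn := tendsto_dressedResolvent R hu1 hu2 hBlim
  have hKid : ∀ ψ : Hhat0.domain,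
      dressedResolvent R B ((l : ℂ) • (ψ : F) - Hhat0 ψ) = ψ := hres0.2.2
  have hinv : ∀ᶠ n in atTop, ∀ ψ : (Hn n).domain,
      dressedResolvent R (Bn n) ((l : ℂ) • (ψ : F) - (Hn n ψ - Sn n ψ)) = ψ := by
    have e1 := (hBlim.const_sub 1).eventually (Units.isOpen.mem_nhds hu1)
    have e2 := (hBlim.star.const_sub 1).eventually (Units.isOpen.mem_nhds hu2)
    filter_upwards [e1, e2] with n h1 h2
    exact dressedResolvent_left_inverse hR h1 h2 (hAdom n) (hAdomStar n) (hAdense n) (hBn n)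
      (hHndom n) (hHnact n) (hSn n)
  have hid : ∀ (z : ℂ) (P Qn : ℕ → F →L[ℂ] F), (∀ n, IsSelfAdjoint (P n)) →
      (∀ n, IsResolventAt (pmapAddB (Hn n) (P n)) z (Qn n)) →
      ∀ᶠ n in atTop,
        Qn n = dressedResolvent R (Bn n) +
          dressedResolvent R (Bn n) * (((l : ℂ) - z) • 1 + (Sn n + P n)) * Qn n ∧
        Qn n = dressedResolvent R (Bn n) +
          Qn n * (((l : ℂ) - z) • 1 + (Sn n + P n)) * dressedResolvent R (Bn n) := by
    intro z P Qn hP hQn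
    filter_upwards [hinv] with n hn
    exact (hQn n).eq_add_mul (hHnsa n) (hP n) (hSnsa n)
      (isSelfAdjoint_dressedResolvent hR (Bn n)) hn
  constructor
  · intro z hz Q Qn hQ hQn
    have hQn' : ∀ n, IsResolventAt (pmapAddB (Hn n) (-Sn n)) z (Qn n) := hQn
    have hP : ∀ n, IsSelfAdjoint (-Sn n) := fun n => (hSnsa n).neg
    refine tendsto_of_resolvent_identity (Vn := fun n => Sn n + -Sn n) (m := (l : ℂ) - z)
      (t := fun _ => 0) (C := 0) (C₁ := |z.im|⁻¹) (C₂ := 0) (ε := fun _ => 0) le_rfl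
      (by positivity) le_rfl hKn (fun _ => le_rfl) tendsto_const_nhds ?_ (by simp) (by simp)
      (hid z _ Qn hP hQn') (fun n => (hQn' n).norm_le (hHnsa n) (hP n) hz) (by simp)
    intro η
    have h := hQ.2.1 η (hQ.1 η)
    exact (hKid ⟨Q η, hQ.1 η⟩).symm.trans
      (congrArg _ (smul_sub_eq_of_smul_sub_eq (by rwa [add_zero])))
  · rintro T - - ⟨a, ha, c, hT⟩ En hEn ⟨a', ha', c', hbound⟩ ⟨ε, hε, hεT⟩ z hz Q Qn hQ hQn
    set D : ℝ := (‖z‖ * ‖Q‖ + 1) + (‖z‖ * ‖Q‖ + 1 + |c| * ‖Q‖) / (1 - a)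
    set D' : ℝ := (‖starRingEnd ℂ z‖ * |z.im|⁻¹ + 1) +
      (‖starRingEnd ℂ z‖ * |z.im|⁻¹ + 1 + |c'| * |z.im|⁻¹) / (1 - a')
    have ha0 : 0 < 1 - a := by linarith
    have ha0' : 0 < 1 - a' := by linarith
    have hD0 : 0 ≤ D := by positivity
    have hD0' : 0 ≤ D' := by positivity
    have hQnorm : ∀ n, ‖Qn n‖ ≤ |z.im|⁻¹ := fun n => (hQn n).norm_le (hHnsa n) (hEn n) hz
    have hQeq : ∀ η, z • Q η - (Hhat0 ⟨Q η, (hQ.1 η).1⟩ + T ⟨Q η, (hQ.1 η).2⟩) = η :=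
      fun η => hQ.2.1 η (hQ.1 η)
    have ht : ∀ η, ‖T ⟨Q η, (hQ.1 η).2⟩‖ ≤ D * ‖η‖ := by
      intro η
      exact norm_le_of_relative_bound ha (Q.le_opNorm η) (hQeq η)
        (hT ⟨Q η, (hQ.1 η).1⟩ (hQ.1 η).2)
    refine tendsto_of_resolvent_identity (Vn := fun n => Sn n + En n) (m := (l : ℂ) - z)
      (t := fun η => T ⟨Q η, (hQ.1 η).2⟩) (C := D) (C₁ := |z.im|⁻¹) (C₂ := D')
      (ε := fun n => |ε n| * (‖Q‖ + D)) hD0 (by positivity) hD0' hKn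
      (fun n => by positivity) ?_ ?_ ht ?_ (hid z En Qn hEn hQn) hQnorm ?_
    · simpa using hε.abs.mul_const (‖Q‖ + D)
    · intro η
      exact (hKid ⟨Q η, (hQ.1 η).1⟩).symm.trans
        (congrArg _ (smul_sub_eq_of_smul_sub_eq (hQeq η)))
    · intro n η
      calc _ ≤ ε n * (‖Q η‖ + ‖T ⟨Q η, (hQ.1 η).2⟩‖) := hεT n ⟨Q η, (hQ.1 η).2⟩
        _ ≤ |ε n| * (‖Q η‖ + ‖T ⟨Q η, (hQ.1 η).2⟩‖) := by
          gcongr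
          exact le_abs_self _
        _ ≤ |ε n| * (‖Q‖ * ‖η‖ + D * ‖η‖) := by
          gcongr
          · exact Q.le_opNorm η
          · exact ht η
        _ = _ := by ring
    · intro n
      have hstar : star (Qn n * (Sn n + En n)) = (Sn n + En n) * adjoint (Qn n) := by
        rw [star_mul, star_add, (hSnsa n).star_eq, (hEn n).star_eq, star_eq_adjoint]
      rw [← norm_star, hstar]
      refine opNorm_le_bound _ hD0' fun η => ?_
      obtain ⟨hmem, hη⟩ := (hQn n).adjoint_right_inverse (hHnsa n) (hEn n) η
      obtain ⟨χ, hχ⟩ : adjoint (Qn n) η ∈ Set.range ⇑R := hHndom n ▸ hmem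
      have hφ : ‖adjoint (Qn n) η‖ ≤ |z.im|⁻¹ * ‖η‖ :=
        le_of_opNorm_le _ ((LinearIsometryEquiv.norm_map adjoint (Qn n)).trans_le (hQnorm n)) η
      change ‖(Sn n + En n) (adjoint (Qn n) η)‖ ≤ _
      generalize adjoint (Qn n) η = φ at hmem hη hχ hφ ⊢
      subst hχ
      have hmem' : R χ ∈ (pmapSub (Hn n) (Sn n)).domain := ⟨hmem, Submodule.mem_top⟩
      refine norm_le_of_relative_bound ha' hφ ?_ (hbound n χ hmem')
      rw [pmapSub_apply, _root_.add_apply, ← add_assoc, sub_add_cancel]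
      exact hη
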